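/- arXiv:1912.08796 — 3 statements merged into one kernel-verified Lean document; each statement's English description precedes it below -/
import Mathlib

section
/- Let α, β, γ ∈ (0,1] satisfy α + β > 1 and β·(2 + γ) > 1. Let g : ℝ → ℝ be bounded and β-Hölder, and let F : ℝ × ℝ → ℝ be differentiable in its second variable with derivative ∂_yF, and suppose there is K > 0 such that for all x, x', y, y' ∈ ℝ: |F(x, y) − F(x', y)| ≤ K·|x − x'|^α, |∂_yF(x, y) − ∂_yF(x, y')| ≤ K·|y − y'|^γ, and |∂_yF(x, y)| ≤ K. Set f(x) := F(x, g(x)). Then for every a < b there exists I ∈ ℝ such that for every ε > 0 there is δ > 0 with the property: for every partition a = x₀ < x₁ < … < x_N = b with max_i (x_{i+1} − x_i) < δ, one has |Σ_{i=0}^{N−1} (1/2)·(f(x_i) + f(x_{i+1}))·(g(x_{i+1}) − g(x_i)) − I| < ε. -/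
open Filter Metric

noncomputable section

/-- Maximal inequality of the sewing argument: if the defect of additivity of `A` is at most
`K * (t - s) ^ θ`, then the sums of `A` along a chain differ from the value of `A` at the endpoints
by at most `C * (t - s) ^ θ`. -/
lemma abs_sum_sub_le_of_defect {A : ℝ → ℝ → ℝ} {a b K C θ : ℝ} (hA : ∀ s, A s s = 0)
    (hK : 0 ≤ K) (hC : 0 ≤ C) (hθ : 0 ≤ θ) (hCK : 2 * C * (1 / 2) ^ θ + 2 * K ≤ C)
    (hdef : ∀ s u t, a ≤ s → s ≤ u → u ≤ t → t ≤ b →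
      |A s t - A s u - A u t| ≤ K * (t - s) ^ θ)
    {x : ℕ → ℝ} (hx : Monotone x) (hxab : ∀ i, x i ∈ Set.Icc a b) (n : ℕ) :
    ∀ i j, i ≤ j → j - i = n →
      |∑ l ∈ Finset.Ico i j, A (x l) (x (l + 1)) - A (x i) (x j)| ≤ C * (x j - x i) ^ θ := by
  induction n using Nat.strong_induction_on with
  | _ n ih =>
    intro i j hij hn
    have hxij : x i ≤ x j := hx hij
    rcases hij.eq_or_lt with rfl | hlt
    · simp only [Finset.Ico_self, Finset.sum_empty, hA, sub_self, abs_zero]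
      exact mul_nonneg hC (Real.rpow_nonneg le_rfl _)
    obtain ⟨k, hik, hkj, hkl, hkr⟩ : ∃ k, i ≤ k ∧ k < j ∧ x k ≤ (x i + x j) / 2 ∧
        (x i + x j) / 2 ≤ x (k + 1) := by
      classical
      have hex : ∃ p, i < p ∧ (x i + x j) / 2 ≤ x p := ⟨j, hlt, by linarith⟩
      obtain ⟨h₁, h₂⟩ := Nat.find_spec hex
      have h₃ := Nat.find_min' hex ⟨hlt, by linarith⟩
      obtain ⟨k, hk⟩ : ∃ k, Nat.find hex = k + 1 := ⟨Nat.find hex - 1, by omega⟩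
      rw [hk] at h₁ h₂ h₃
      refine ⟨k, by omega, by omega, ?_, h₂⟩
      rcases (Nat.lt_succ_iff.mp h₁).eq_or_lt with rfl | hik
      · linarith
      · have := Nat.find_min hex (m := k) (by omega)
        push Not at this
        exact (this hik).le
    have hkk : x k ≤ x (k + 1) := hx k.le_succ
    have hxik : x i ≤ x k := hx hik
    have hxkj : x (k + 1) ≤ x j := hx hkj
    have hleft := ih (k - i) (by omega) i k hik rfl
    have hright := ih (j - (k + 1)) (by omega) (k + 1) j hkj rfl
    have hd₁ := hdef (x i) (x k) (x j) (hxab i).1 hxik (hkk.trans hxkj) (hxab j).2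
    have hd₂ := hdef (x k) (x (k + 1)) (x j) (hxab k).1 hkk hxkj (hxab j).2
    have hhalf : ((x j - x i) / 2) ^ θ = (x j - x i) ^ θ * (1 / 2) ^ θ := by
      rw [← Real.mul_rpow (by linarith) (by norm_num)]
      ring_nf
    have hl : C * (x k - x i) ^ θ ≤ C * ((x j - x i) ^ θ * (1 / 2) ^ θ) := by
      rw [← hhalf]
      exact mul_le_mul_of_nonneg_left
        (Real.rpow_le_rpow (by linarith) (by linarith) hθ) hC
    have hr : C * (x j - x (k + 1)) ^ θ ≤ C * ((x j - x i) ^ θ * (1 / 2) ^ θ) := by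
      rw [← hhalf]
      exact mul_le_mul_of_nonneg_left
        (Real.rpow_le_rpow (by linarith) (by linarith) hθ) hC
    have hm : K * (x j - x k) ^ θ ≤ K * (x j - x i) ^ θ :=
      mul_le_mul_of_nonneg_left (Real.rpow_le_rpow (by linarith) (by linarith) hθ) hK
    have hfin := mul_le_mul_of_nonneg_right hCK
      (Real.rpow_nonneg (sub_nonneg.mpr hxij) θ)
    rw [← Finset.sum_Ico_consecutive _ hik hkj.le, Finset.sum_eq_sum_Ico_succ_bot hkj]
    rw [abs_le] at *
    constructor <;> linarith

/-- Clamping `[p, q]` to `[u, v]` and clamping `[u, v]` to `[p, q]` give the same interval, up to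
degenerate intervals. -/
lemma clamp_comm {A : ℝ → ℝ → ℝ} (hA : ∀ s, A s s = 0) {u v p q : ℝ} (huv : u ≤ v) (hpq : p ≤ q) :
    A (max u (min v p)) (max u (min v q)) = A (max p (min q u)) (max p (min q v)) := by
  rcases le_total q u with h | h
  · rw [min_eq_right (h.trans huv), max_eq_left h, min_eq_right (hpq.trans (h.trans huv)),
      max_eq_left (hpq.trans h), min_eq_left h, min_eq_left (h.trans huv), hA, hA]
  rcases le_total v p with h' | h'
  · rw [min_eq_left h', min_eq_left (h'.trans hpq), min_eq_right h,
      min_eq_right (h'.trans hpq), max_eq_left h', max_eq_left (huv.trans h'), hA, hA]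
  rw [min_eq_right h', min_eq_right h, max_eq_right (le_min huv h), max_eq_right (le_min hpq h'),
    max_comm, min_comm]

/-- Sums of `A` along two chains with the same endpoints differ by at most the sum of the errors
made on the individual intervals. -/
lemma abs_sum_sub_sum_le_of_defect {A : ℝ → ℝ → ℝ} {a b K C θ : ℝ} (hA : ∀ s, A s s = 0)
    (hK : 0 ≤ K) (hC : 0 ≤ C) (hθ : 0 ≤ θ) (hCK : 2 * C * (1 / 2) ^ θ + 2 * K ≤ C)
    (hdef : ∀ s u t, a ≤ s → s ≤ u → u ≤ t → t ≤ b →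
      |A s t - A s u - A u t| ≤ K * (t - s) ^ θ)
    {x y : ℕ → ℝ} (hx : Monotone x) (hxab : ∀ i, x i ∈ Set.Icc a b)
    (hy : Monotone y) (hyab : ∀ i, y i ∈ Set.Icc a b) {m n : ℕ}
    (hx0 : x 0 = a) (hxm : x m = b) (hy0 : y 0 = a) (hyn : y n = b) :
    |∑ i ∈ Finset.range m, A (x i) (x (i + 1)) - ∑ j ∈ Finset.range n, A (y j) (y (j + 1))| ≤
      C * ∑ i ∈ Finset.range m, (x (i + 1) - x i) ^ θ +
      C * ∑ j ∈ Finset.range n, (y (j + 1) - y j) ^ θ := by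
  have key : ∀ {z : ℕ → ℝ} {k : ℕ} {u v : ℝ}, Monotone z → z 0 = a → z k = b → a ≤ u → u ≤ v →
      v ≤ b → |∑ l ∈ Finset.range k, A (max u (min v (z l))) (max u (min v (z (l + 1)))) - A u v| ≤
        C * (v - u) ^ θ := by
    intro z k u v hz hz0 hzk hau huv hvb
    have h := abs_sum_sub_le_of_defect hA hK hC hθ hCK hdef
      (x := fun l ↦ max u (min v (z l)))
      (fun i j hij ↦ max_le_max le_rfl (min_le_min le_rfl (hz hij)))
      (fun i ↦ ⟨hau.trans (le_max_left _ _),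
        max_le (huv.trans hvb) ((min_le_left _ _).trans hvb)⟩) k 0 k (Nat.zero_le _) rfl
    simpa only [hz0, hzk, min_eq_right (hau.trans huv), min_eq_left hvb, max_eq_left hau,
      max_eq_right huv, Finset.range_eq_Ico] using h
  have hxy : ∑ i ∈ Finset.range m, ∑ j ∈ Finset.range n,
        A (max (x i) (min (x (i + 1)) (y j))) (max (x i) (min (x (i + 1)) (y (j + 1)))) =
      ∑ j ∈ Finset.range n, ∑ i ∈ Finset.range m,
        A (max (y j) (min (y (j + 1)) (x i))) (max (y j) (min (y (j + 1)) (x (i + 1)))) := by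
    rw [Finset.sum_comm]
    exact Finset.sum_congr rfl fun j _ ↦ Finset.sum_congr rfl fun i _ ↦
      clamp_comm hA (hx i.le_succ) (hy j.le_succ)
  have h₁ := (Finset.abs_sum_le_sum_abs _ _).trans
    (Finset.sum_le_sum fun i (_ : i ∈ Finset.range m) ↦
    key hy hy0 hyn (hxab i).1 (hx i.le_succ) (hxab (i + 1)).2)
  have h₂ := (Finset.abs_sum_le_sum_abs _ _).trans
    (Finset.sum_le_sum fun j (_ : j ∈ Finset.range n) ↦
    key hx hx0 hxm (hyab j).1 (hy j.le_succ) (hyab (j + 1)).2)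
  rw [Finset.sum_sub_distrib, ← Finset.mul_sum] at h₁ h₂
  rw [hxy] at h₁
  rw [abs_le] at *
  constructor <;> linarith

/-- A chain from `a` to `b` with mesh at most `d` has small sum of `θ`-th powers of its steps. -/
lemma sum_rpow_le_of_mesh_le {a b d θ : ℝ} (hθ : 1 ≤ θ) {x : ℕ → ℝ} (hx : Monotone x) {m : ℕ}
    (hx0 : x 0 = a) (hxm : x m = b) (hd : ∀ i < m, x (i + 1) - x i ≤ d) :
    ∑ i ∈ Finset.range m, (x (i + 1) - x i) ^ θ ≤ d ^ (θ - 1) * (b - a) := by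
  rw [← hx0, ← hxm, ← Finset.sum_range_sub, Finset.mul_sum]
  refine Finset.sum_le_sum fun i hi ↦ ?_
  have h0 : 0 ≤ x (i + 1) - x i := sub_nonneg.mpr (hx i.le_succ)
  calc (x (i + 1) - x i) ^ θ = (x (i + 1) - x i) ^ (θ - 1) * (x (i + 1) - x i) := by
        rw [← Real.rpow_add_one' h0 (by linarith), sub_add_cancel]
    _ ≤ d ^ (θ - 1) * (x (i + 1) - x i) := mul_le_mul_of_nonneg_right
        (Real.rpow_le_rpow h0 (hd i (Finset.mem_range.mp hi)) (by linarith)) h0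

/-- The sewing lemma on `[a, b]`, in the form of convergence of sums as the mesh tends to zero. -/
theorem exists_limit_of_defect {A : ℝ → ℝ → ℝ} {a b K θ : ℝ} (hab : a ≤ b) (hA : ∀ s, A s s = 0)
    (hK : 0 ≤ K) (hθ : 1 < θ)
    (hdef : ∀ s u t, a ≤ s → s ≤ u → u ≤ t → t ≤ b →
      |A s t - A s u - A u t| ≤ K * (t - s) ^ θ) :
    ∃ I : ℝ, ∀ ε > (0 : ℝ), ∃ δ > (0 : ℝ), ∀ (m : ℕ) (x : ℕ → ℝ), x 0 = a → x m = b →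
      (∀ i < m, x i ≤ x (i + 1)) → (∀ i < m, x (i + 1) - x i < δ) →
      |∑ i ∈ Finset.range m, A (x i) (x (i + 1)) - I| < ε := by
  have hq : (1 / 2 : ℝ) ^ θ < 1 / 2 := by
    simpa using Real.rpow_lt_rpow_of_exponent_gt (x := (1 / 2 : ℝ)) (by norm_num) (by norm_num) hθ
  obtain ⟨C, hC, hCK⟩ : ∃ C : ℝ, 0 ≤ C ∧ 2 * C * (1 / 2) ^ θ + 2 * K ≤ C := by
    have hpos : 0 < 1 - 2 * (1 / 2 : ℝ) ^ θ := by linarith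
    refine ⟨2 * K / (1 - 2 * (1 / 2 : ℝ) ^ θ), by positivity, le_of_eq ?_⟩
    field_simp
    ring
  have hθ0 : 0 < θ - 1 := sub_pos.mpr hθ
  have compare : ∀ {x y : ℕ → ℝ} {m n : ℕ} {d e : ℝ}, Monotone x → (∀ i, x i ∈ Set.Icc a b) →
      x 0 = a → x m = b → (∀ i < m, x (i + 1) - x i ≤ d) →
      Monotone y → (∀ i, y i ∈ Set.Icc a b) →
      y 0 = a → y n = b → (∀ i < n, y (i + 1) - y i ≤ e) →
      |∑ i ∈ Finset.range m, A (x i) (x (i + 1)) - ∑ j ∈ Finset.range n, A (y j) (y (j + 1))| ≤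
        C * (d ^ (θ - 1) * (b - a)) + C * (e ^ (θ - 1) * (b - a)) := by
    intro x y m n d e hx hxab hx0 hxm hxd hy hyab hy0 hyn hye
    exact (abs_sum_sub_sum_le_of_defect hA hK hC (by linarith) hCK hdef hx hxab hy hyab
      hx0 hxm hy0 hyn).trans (add_le_add
        (mul_le_mul_of_nonneg_left (sum_rpow_le_of_mesh_le hθ.le hx hx0 hxm hxd) hC)
        (mul_le_mul_of_nonneg_left (sum_rpow_le_of_mesh_le hθ.le hy hy0 hyn hye) hC))
  have hab0 : 0 ≤ b - a := sub_nonneg.mpr hab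
  let d : ℕ → ℝ := fun n ↦ (b - a) * (1 / ((n : ℝ) + 1))
  let u : ℕ → ℕ → ℝ := fun n i ↦ min (a + d n * i) b
  have hd0 : ∀ n, 0 ≤ d n := fun n ↦ by positivity
  have hu : ∀ n, Monotone (u n) := fun n i j hij ↦ min_le_min
    (by have := mul_le_mul_of_nonneg_left (Nat.cast_le (α := ℝ).mpr hij) (hd0 n); linarith) le_rfl
  have hu0 : ∀ n, u n 0 = a := fun n ↦ by simp [u, hab]
  have hun : ∀ n, u n (n + 1) = b := fun n ↦ by
    have : d n * ((n : ℝ) + 1) = b - a := by simp only [d]; field_simp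
    simp [u, this]
  have huab : ∀ n i, u n i ∈ Set.Icc a b := fun n i ↦
    ⟨by rw [← hu0 n]; exact hu n (Nat.zero_le i), min_le_right _ _⟩
  have hud : ∀ n, ∀ i < n + 1, u n (i + 1) - u n i ≤ d n := fun n i _ ↦ by
    simp only [u, Nat.cast_succ]
    rcases min_cases (a + d n * i) b with h | h <;>
      rcases min_cases (a + d n * (i + 1)) b with h' | h' <;> linarith [hd0 n]
  have hlim : Tendsto (fun t : ℝ ↦ C * (t ^ (θ - 1) * (b - a))) (nhds 0) (nhds 0) := by
    have h := ((Real.continuousAt_rpow_const 0 (θ - 1) (Or.inr hθ0.le)).tendsto.mul_const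
      (b - a)).const_mul C
    simpa [Real.zero_rpow hθ0.ne'] using h
  have hdlim : Tendsto d atTop (nhds 0) := by
    simpa [d] using tendsto_one_div_add_atTop_nhds_zero_nat.const_mul (b - a)
  let S : ℕ → ℝ := fun n ↦ ∑ i ∈ Finset.range (n + 1), A (u n i) (u n (i + 1))
  have hmono : ∀ {s t : ℝ}, 0 ≤ s → s ≤ t →
      C * (s ^ (θ - 1) * (b - a)) ≤ C * (t ^ (θ - 1) * (b - a)) := fun hs hst ↦
    mul_le_mul_of_nonneg_left (mul_le_mul_of_nonneg_right
      (Real.rpow_le_rpow hs hst hθ0.le) hab0) hC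
  have hdanti : ∀ {n k : ℕ}, n ≤ k → d k ≤ d n := fun hnk ↦
    mul_le_mul_of_nonneg_left (Nat.one_div_le_one_div hnk) hab0
  have hcauchy : CauchySeq S := by
    refine cauchySeq_of_le_tendsto_0 (fun n ↦ C * (d n ^ (θ - 1) * (b - a)) +
      C * (d n ^ (θ - 1) * (b - a))) (fun n k l hn hl ↦ ?_) ?_
    · exact (compare (hu n) (huab n) (hu0 n) (hun n) (hud n) (hu k) (huab k) (hu0 k) (hun k)
        (hud k)).trans (add_le_add (hmono (hd0 _) (hdanti hn)) (hmono (hd0 _) (hdanti hl)))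
    · simpa using (hlim.comp hdlim).add (hlim.comp hdlim)
  obtain ⟨I, hI⟩ := cauchySeq_tendsto_of_complete hcauchy
  refine ⟨I, fun ε hε ↦ ?_⟩
  obtain ⟨δ, hδε, hδ⟩ := (((hlim.eventually (gt_mem_nhds hε)).filter_mono
    nhdsWithin_le_nhds).and (self_mem_nhdsWithin (s := Set.Ioi (0 : ℝ)))).exists
  refine ⟨δ, hδ, fun m x hx0 hxm hx hxδ ↦ lt_of_le_of_lt ?_ hδε⟩
  let y : ℕ → ℝ := fun i ↦ x (min i m)
  have hy : Monotone y := monotone_nat_of_le_succ fun i ↦ by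
    rcases lt_or_ge i m with h | h
    · simpa [y, h.le, Nat.succ_le_of_lt h] using hx i h
    · simp [y, h, h.trans i.le_succ]
  have hyab : ∀ i, y i ∈ Set.Icc a b := fun i ↦ by
    constructor
    · simpa [y, hx0] using hy (Nat.zero_le i)
    · simpa [y, hxm] using hy (le_max_left i m)
  have hyx : ∀ i < m, y i = x i ∧ y (i + 1) = x (i + 1) := fun i h ↦ by
    simp [y, h.le, Nat.succ_le_of_lt h]
  have hsum : ∑ i ∈ Finset.range m, A (x i) (x (i + 1)) =
      ∑ i ∈ Finset.range m, A (y i) (y (i + 1)) := Finset.sum_congr rfl fun i hi ↦ by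
    rw [(hyx i (Finset.mem_range.mp hi)).1, (hyx i (Finset.mem_range.mp hi)).2]
  rw [hsum]
  refine le_of_tendsto_of_tendsto' (hI.const_sub _).abs
    (by simpa using (hlim.comp hdlim).const_add (C * (δ ^ (θ - 1) * (b - a)))) fun n ↦
    compare (d := δ) hy hyab (by simp [y, hx0]) (by simp [y, hxm])
      (fun i hi ↦ by rw [(hyx i hi).1, (hyx i hi).2]; exact (hxδ i hi).le)
      (hu n) (huab n) (hu0 n) (hun n) (hud n)

/-- First-order Taylor estimate for a function with `γ`-Hölder derivative. -/
lemma abs_taylor_le_of_holder_deriv {φ : ℝ → ℝ} {K γ : ℝ} (hK : 0 ≤ K) (hγ : 0 ≤ γ)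
    (hφ : Differentiable ℝ φ)
    (hφ' : ∀ y y', |deriv φ y - deriv φ y'| ≤ K * |y - y'| ^ γ) (y z : ℝ) :
    |φ z - φ y - deriv φ y * (z - y)| ≤ K * |z - y| ^ γ * |z - y| := by
  have h := (convex_uIcc y z).norm_image_sub_le_of_norm_hasDerivWithin_le
    (f := fun w ↦ φ w - deriv φ y * w) (f' := fun w ↦ deriv φ w - deriv φ y)
    (C := K * |z - y| ^ γ)
    (fun w _ ↦ by
      simpa [Pi.sub_def] using
        ((hφ w).hasDerivAt.sub ((hasDerivAt_id w).const_mul (deriv φ y))).hasDerivWithinAt)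
    (fun w hw ↦ (hφ' w y).trans (mul_le_mul_of_nonneg_left
      (Real.rpow_le_rpow (abs_nonneg _) (Set.abs_sub_left_of_mem_uIcc hw) hγ) hK))
    Set.left_mem_uIcc Set.right_mem_uIcc
  rw [Real.norm_eq_abs, Real.norm_eq_abs] at h
  convert h using 2
  ring

/-- Additivity defect of the trapezoidal approximation of `∫ F(x, g(x)) dg(x)`. -/
lemma abs_trapezoid_defect_le {α β γ Hg K : ℝ} (hα : 0 ≤ α) (hβ : 0 ≤ β) (hγ : 0 ≤ γ)
    (hHg : 0 ≤ Hg) (hK : 0 ≤ K) {g : ℝ → ℝ} (hg : ∀ x y, |g x - g y| ≤ Hg * |x - y| ^ β)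
    {F : ℝ → ℝ → ℝ} (hFdiff : ∀ x, Differentiable ℝ (F x))
    (hFx : ∀ x x' y, |F x y - F x' y| ≤ K * |x - x'| ^ α)
    (hFy : ∀ x y y', |deriv (F x) y - deriv (F x) y'| ≤ K * |y - y'| ^ γ)
    {s u t : ℝ} (hsu : s ≤ u) (hut : u ≤ t) :
    |1 / 2 * (F s (g s) + F t (g t)) * (g t - g s) - 1 / 2 * (F s (g s) + F u (g u)) * (g u - g s)
        - 1 / 2 * (F u (g u) + F t (g t)) * (g t - g u)| ≤
      Hg * K * (t - s) ^ (α + β) + Hg * K * Hg ^ γ * Hg * (t - s) ^ (β * (2 + γ)) := by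
  have hst : 0 ≤ t - s := by linarith
  have hpow : ∀ {x y p : ℝ}, 0 ≤ p → |x - y| ≤ t - s → |x - y| ^ p ≤ (t - s) ^ p := fun hp h ↦
    Real.rpow_le_rpow (abs_nonneg _) h hp
  have htu : |t - u| ≤ t - s := by rw [abs_of_nonneg] <;> linarith
  have hus : |u - s| ≤ t - s := by rw [abs_of_nonneg] <;> linarith
  have hc : |g t - g u| ≤ Hg * (t - s) ^ β :=
    (hg t u).trans (mul_le_mul_of_nonneg_left (hpow hβ htu) hHg)
  have he : |g u - g s| ≤ Hg * (t - s) ^ β :=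
    (hg u s).trans (mul_le_mul_of_nonneg_left (hpow hβ hus) hHg)
  have hB : 0 ≤ Hg * (t - s) ^ β := by positivity
  have hr : ∀ z, |z - g u| ≤ Hg * (t - s) ^ β → |F u z - F u (g u) - deriv (F u) (g u) * (z - g u)| ≤
      K * (Hg * (t - s) ^ β) ^ γ * (Hg * (t - s) ^ β) := fun z hz ↦
    (abs_taylor_le_of_holder_deriv hK hγ (hFdiff u) (hFy u) (g u) z).trans
      (mul_le_mul (mul_le_mul_of_nonneg_left (Real.rpow_le_rpow (abs_nonneg _) hz hγ) hK) hz
        (abs_nonneg _) (by positivity))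
  have hrt := hr (g t) hc
  have hrs := hr (g s) (by rwa [abs_sub_comm])
  have hFt := (hFx t u (g t)).trans (mul_le_mul_of_nonneg_left (hpow hα htu) hK)
  have hFs := (hFx u s (g s)).trans (mul_le_mul_of_nonneg_left (hpow hα hus) hK)
  set R := K * (t - s) ^ α + K * (Hg * (t - s) ^ β) ^ γ * (Hg * (t - s) ^ β) with hR
  have hRe : R * (Hg * (t - s) ^ β) =
      Hg * K * (t - s) ^ (α + β) + Hg * K * Hg ^ γ * Hg * (t - s) ^ (β * (2 + γ)) := by
    have h₁ : (t - s) ^ (β * (2 + γ)) = (t - s) ^ β * (t - s) ^ (β * γ) * (t - s) ^ β := by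
      rw [← Real.rpow_add_of_nonneg hst hβ (by positivity),
        ← Real.rpow_add_of_nonneg hst (by positivity) hβ]
      ring_nf
    rw [hR, h₁, Real.rpow_add_of_nonneg hst hα hβ, Real.mul_rpow hHg (by positivity),
      ← Real.rpow_mul hst]
    ring
  set D := deriv (F u) (g u)
  have h₁ : |F t (g t) - F u (g u) - D * (g t - g u)| ≤ R := by
    rw [hR]
    refine le_trans (le_of_eq ?_) ((abs_add_le _ _).trans (add_le_add hFt hrt))
    ring_nf
  have h₂ : |F u (g u) - F s (g s) - D * (g u - g s)| ≤ R := by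
    rw [hR]
    refine le_trans (le_of_eq ?_) ((abs_sub _ _).trans (add_le_add hFs hrs))
    ring_nf
  have hR0 : 0 ≤ R := (abs_nonneg _).trans h₁
  have h₃ := mul_le_mul h₁ he (abs_nonneg _) hR0
  have h₄ := mul_le_mul h₂ hc (abs_nonneg _) hR0
  rw [← abs_mul] at h₃ h₄
  rw [← hRe]
  rw [abs_le] at h₃ h₄ ⊢
  constructor <;> linarith

/-- On `[0, L]`, a larger power is controlled by a smaller one. -/
lemma rpow_le_rpow_mul_rpow_sub {h L θ p : ℝ} (h0 : 0 ≤ h) (hL : h ≤ L) (hθ : 0 ≤ θ)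
    (hp : θ ≤ p) : h ^ p ≤ L ^ (p - θ) * h ^ θ := by
  calc h ^ p = h ^ (p - θ) * h ^ θ := by
        rw [← Real.rpow_add_of_nonneg h0 (sub_nonneg.mpr hp) hθ, sub_add_cancel]
    _ ≤ L ^ (p - θ) * h ^ θ := mul_le_mul_of_nonneg_right
        (Real.rpow_le_rpow h0 hL (sub_nonneg.mpr hp)) (Real.rpow_nonneg h0 _)

/-- one-dimensional Stratonovich-type sums for `f(x) = F(x, g(x))` converge
along any sequence of partitions with mesh tending to zero. -/
theorem stmt_16 (α β γ : ℝ) (hα : α ∈ Set.Ioc (0:ℝ) 1) (hβ : β ∈ Set.Ioc (0:ℝ) 1)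
    (hγ : γ ∈ Set.Ioc (0:ℝ) 1) (hsum1 : 1 < α + β) (hsum2 : 1 < β * (2 + γ))
    (g : ℝ → ℝ) (M Hg : ℝ) (hgb : ∀ x, |g x| ≤ M)
    (hg : ∀ x y, |g x - g y| ≤ Hg * |x - y| ^ β)
    (F : ℝ → ℝ → ℝ) (K : ℝ) (hK : 0 < K)
    (hFdiff : ∀ x, Differentiable ℝ (F x))
    (hFx : ∀ x x' y, |F x y - F x' y| ≤ K * |x - x'| ^ α)
    (hFy : ∀ x y y', |deriv (F x) y - deriv (F x) y'| ≤ K * |y - y'| ^ γ)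
    (hFyb : ∀ x y, |deriv (F x) y| ≤ K)
    (a b : ℝ) (hab : a < b) :
    ∃ I : ℝ, ∀ ε > (0:ℝ), ∃ δ > (0:ℝ),
      ∀ (N : ℕ) (x : ℕ → ℝ), 0 < N → x 0 = a → x N = b →
        (∀ i < N, x i < x (i + 1)) →
        (∀ i < N, x (i + 1) - x i < δ) →
        |(∑ i ∈ Finset.range N,
            (1/2) * (F (x i) (g (x i)) + F (x (i+1)) (g (x (i+1))))
              * (g (x (i+1)) - g (x i))) - I| < ε := by
  have hHg : 0 ≤ Hg := by simpa using (abs_nonneg _).trans (hg 0 1)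
  set θ := min (α + β) (β * (2 + γ)) with hθdef
  have hθ : 1 < θ := lt_min hsum1 hsum2
  have hL : 0 < b - a := sub_pos.mpr hab
  obtain ⟨I, hI⟩ := exists_limit_of_defect (θ := θ)
    (A := fun s t ↦ (1/2) * (F s (g s) + F t (g t)) * (g t - g s))
    (K := Hg * K * (b - a) ^ (α + β - θ) + Hg * K * Hg ^ γ * Hg * (b - a) ^ (β * (2 + γ) - θ))
    hab.le (fun s ↦ by simp) (by positivity) hθ (fun s u t has hsu hut htb ↦ by
      refine (abs_trapezoid_defect_le hα.1.le hβ.1.le hγ.1.le hHg hK.le hg hFdiff hFx hFy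
        hsu hut).trans ?_
      rw [add_mul, mul_assoc _ _ ((t - s) ^ θ), mul_assoc _ _ ((t - s) ^ θ)]
      refine add_le_add (mul_le_mul_of_nonneg_left ?_ (by positivity))
        (mul_le_mul_of_nonneg_left ?_ (by positivity))
      · exact rpow_le_rpow_mul_rpow_sub (by linarith) (by linarith) (by linarith) (min_le_left _ _)
      · exact rpow_le_rpow_mul_rpow_sub (by linarith) (by linarith) (by linarith)
          (min_le_right _ _))
  refine ⟨I, fun ε hε ↦ ?_⟩
  obtain ⟨δ, hδ, h⟩ := hI ε hε
  exact ⟨δ, hδ, fun N x _ hx0 hxN hx hxδ ↦ h N x hx0 hxN (fun i hi ↦ (hx i hi).le) hxδ⟩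
end
end

section
/- Let ω : (ℝ²)³ → ℝ be a 2-germ. Suppose the pairs (S, V) and (S', V'), with S, S' : (ℝ²)² → ℝ and V, V' : (ℝ²)³ → ℝ, both satisfy the following four conditions (stated here for (S, V)): (a) for every ε > 0 there is δ > 0 such that |S_{pq}| ≤ ε·|p − q| whenever |p − q| < δ; (b) for every ε > 0 there is δ > 0 such that |ω_{pqr} − V_{pqr} + (δS)_{pqr}| ≤ ε·diam([pqr])² whenever diam([pqr]) < δ, where (δS)_{pqr} := S_{qr} − S_{pr} + S_{pq}; (c) (δS)_{prq} = ω_{prq} whenever r = (p + q)/2; (d) V_{p₀p₁p₂} = V_{q₀q₁q₂} + V_{q₁q₀p₂} + V_{q₂p₁q₀} + V_{p₀q₂q₁} for all p₀, p₁, p₂, where q_i := (p_j + p_ℓ)/2 for {i,j,ℓ} = {0,1,2}. Then S = S' and V = V'. -/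
open Filter Metric

noncomputable section

/-- The plane `ℝ²`. -/
abbrev E2 : Type := EuclideanSpace ℝ (Fin 2)

/-- The Stratonovich germ of `(f, g¹, g²)`. -/
def strat (f g1 g2 : E2 → ℝ) (p q r : E2) : ℝ :=
  (1/2) * ((f p + f q + f r)/3) *
    ((g1 q - g1 p) * (g2 r - g2 p) - (g1 r - g1 p) * (g2 q - g2 p))

/-- The Itô germ of `(f, g¹, g²)`. -/
def ito (f g1 g2 : E2 → ℝ) (p q r : E2) : ℝ :=
  (1/2) * f p *
    ((g1 q - g1 p) * (g2 r - g2 p) - (g1 r - g1 p) * (g2 q - g2 p))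

/-- Coboundary of a 2-germ. -/
def cob (ω : E2 → E2 → E2 → ℝ) (p q r s : E2) : ℝ :=
  ω q r s - ω p r s + ω p q s - ω p q r

/-- Dyadic sums `ω^n` of a 2-germ `ω`. -/
def dyaSum (ω : E2 → E2 → E2 → ℝ) : ℕ → E2 → E2 → E2 → ℝ
  | 0 => ω
  | n + 1 => fun p0 p1 p2 =>
      dyaSum ω n (midpoint ℝ p1 p2) (midpoint ℝ p0 p2) (midpoint ℝ p0 p1)
      + dyaSum ω n (midpoint ℝ p0 p2) (midpoint ℝ p1 p2) p2
      + dyaSum ω n (midpoint ℝ p0 p1) p1 (midpoint ℝ p1 p2)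
      + dyaSum ω n p0 (midpoint ℝ p0 p1) (midpoint ℝ p0 p2)

/-- Side correctors `S^n` of a 2-germ `ω`. -/
def sideCorr (ω : E2 → E2 → E2 → ℝ) : ℕ → E2 → E2 → ℝ
  | 0 => fun _ _ => 0
  | n + 1 => fun p q =>
      ω p (midpoint ℝ p q) q + sideCorr ω n p (midpoint ℝ p q)
        + sideCorr ω n (midpoint ℝ p q) q

/-- A 2-germ is alternating if it changes sign according to the sign of permutations
of its three arguments. -/
def Alternating2 (ω : E2 → E2 → E2 → ℝ) : Prop :=
  ∀ (σ : Equiv.Perm (Fin 3)) (p : Fin 3 → E2),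
    ω (p (σ 0)) (p (σ 1)) (p (σ 2)) = ((Equiv.Perm.sign σ : ℤ) : ℝ) * ω (p 0) (p 1) (p 2)


/-- The medial segment of a triangle has half the length of the opposite side. -/
theorem dist_midpoint_midpoint_eq_half {E : Type*} [NormedAddCommGroup E] [NormedSpace ℝ E]
    (a b c : E) : dist (midpoint ℝ a b) (midpoint ℝ a c) = dist b c / 2 := by
  have h : midpoint ℝ a b - midpoint ℝ a c = (2⁻¹ : ℝ) • (b - c) := by
    simp only [midpoint_eq_smul_add, invOf_eq_inv]
    module
  rw [dist_eq_norm, h, norm_smul, dist_eq_norm]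
  norm_num
  ring

/-- A midpoint-additive 1-germ of order `o(|p - q|)` vanishes. -/
theorem eq_zero_of_midpoint_additive {E : Type*} [NormedAddCommGroup E] [NormedSpace ℝ E]
    (D : E → E → ℝ)
    (hsmall : ∀ ε > (0:ℝ), ∃ δ > (0:ℝ), ∀ p q : E, dist p q < δ → |D p q| ≤ ε * dist p q)
    (hadd : ∀ p q : E, D p q = D p (midpoint ℝ p q) + D (midpoint ℝ p q) q) (p q : E) :
    D p q = 0 := by
  have bound : ∀ ε > (0:ℝ), |D p q| ≤ ε * dist p q := by
    intro ε hε
    obtain ⟨δ, hδ, h⟩ := hsmall ε hε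
    have scale : ∀ (n : ℕ) (p q : E), dist p q < 2 ^ n * δ → |D p q| ≤ ε * dist p q := by
      intro n
      induction n with
      | zero => intro p q hpq; exact h p q (by simpa using hpq)
      | succ n ih =>
        intro p q hpq
        have hl : dist p (midpoint ℝ p q) = dist p q / 2 := by
          rw [dist_left_midpoint]; norm_num; ring
        have hr : dist (midpoint ℝ p q) q = dist p q / 2 := by
          rw [dist_midpoint_right]; norm_num; ring
        rw [pow_succ] at hpq
        have h₁ := ih p (midpoint ℝ p q) (by linarith)
        have h₂ := ih (midpoint ℝ p q) q (by linarith)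
        rw [hl] at h₁
        rw [hr] at h₂
        rw [hadd p q]
        linarith [abs_add_le (D p (midpoint ℝ p q)) (D (midpoint ℝ p q) q)]
    obtain ⟨n, hn⟩ := pow_unbounded_of_one_lt (dist p q / δ) (one_lt_two : (1:ℝ) < 2)
    exact scale n p q ((div_lt_iff₀ hδ).1 hn)
  refine abs_nonpos_iff.1 (le_of_forall_pos_le_add fun η hη => ?_)
  have hd : 0 ≤ dist p q := dist_nonneg
  calc |D p q| ≤ η / (dist p q + 1) * dist p q := bound _ (by positivity)
    _ ≤ 0 + η := by
      rw [div_mul_eq_mul_div, div_le_iff₀ (by positivity)]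
      nlinarith

/-- A 2-germ of order `o(diam²)` that is additive under the dyadic subdivision of triangles
vanishes. -/
theorem eq_zero_of_dyadic_additive {E : Type*} [NormedAddCommGroup E] [NormedSpace ℝ E]
    (W : E → E → E → ℝ)
    (hsmall : ∀ ε > (0:ℝ), ∃ δ > (0:ℝ), ∀ p q r : E, Metric.diam ({p, q, r} : Set E) < δ →
      |W p q r| ≤ ε * Metric.diam ({p, q, r} : Set E) ^ 2)
    (hadd : ∀ p0 p1 p2 : E,
      W p0 p1 p2 =
        W (midpoint ℝ p1 p2) (midpoint ℝ p0 p2) (midpoint ℝ p0 p1)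
        + W (midpoint ℝ p0 p2) (midpoint ℝ p1 p2) p2
        + W (midpoint ℝ p0 p1) p1 (midpoint ℝ p1 p2)
        + W p0 (midpoint ℝ p0 p1) (midpoint ℝ p0 p2))
    (p q r : E) : W p q r = 0 := by
  have bound : ∀ ε > (0:ℝ), |W p q r| ≤ ε * Metric.diam ({p, q, r} : Set E) ^ 2 := by
    intro ε hε
    obtain ⟨δ, hδ, h⟩ := hsmall ε hε
    have scale : ∀ (n : ℕ) (p q r : E) (d : ℝ), dist p q ≤ d → dist p r ≤ d → dist q r ≤ d →
        d < 2 ^ n * δ → |W p q r| ≤ ε * d ^ 2 := by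
      intro n
      induction n with
      | zero =>
        intro p q r d hpq hpr hqr hd
        have hle : Metric.diam ({p, q, r} : Set E) ≤ d := by
          rw [Metric.diam_triple]
          exact max_le (max_le hpq hpr) hqr
        have hnn : 0 ≤ Metric.diam ({p, q, r} : Set E) := Metric.diam_nonneg
        refine (h p q r (by linarith)).trans ?_
        gcongr
      | succ n ih =>
        intro p q r d hpq hpr hqr hd
        rw [pow_succ] at hd
        have hd' : d / 2 < 2 ^ n * δ := by linarith
        have left (a b : E) : dist a (midpoint ℝ a b) = dist a b / 2 := by
          rw [dist_left_midpoint]; norm_num; ring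
        have right (a b : E) : dist (midpoint ℝ a b) b = dist a b / 2 := by
          rw [dist_midpoint_right]; norm_num; ring
        have e₀ := dist_midpoint_midpoint_eq_half p q r
        have e₁ := dist_midpoint_midpoint_eq_half q p r
        have e₂ := dist_midpoint_midpoint_eq_half r p q
        rw [midpoint_comm (R := ℝ) q p] at e₁
        rw [midpoint_comm (R := ℝ) r p, midpoint_comm (R := ℝ) r q] at e₂
        have h₁ := ih (midpoint ℝ q r) (midpoint ℝ p r) (midpoint ℝ p q) (d / 2)
          (by rw [dist_comm]; linarith) (by rw [dist_comm]; linarith)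
          (by rw [dist_comm]; linarith) hd'
        have h₂ := ih (midpoint ℝ p r) (midpoint ℝ q r) r (d / 2)
          (by linarith) (by linarith [right p r]) (by linarith [right q r]) hd'
        have h₃ := ih (midpoint ℝ p q) q (midpoint ℝ q r) (d / 2)
          (by linarith [right p q]) (by linarith) (by linarith [left q r]) hd'
        have h₄ := ih p (midpoint ℝ p q) (midpoint ℝ p r) (d / 2)
          (by linarith [left p q]) (by linarith [left p r]) (by linarith) hd'
        rw [hadd p q r]
        rw [abs_le] at *
        constructor <;> linarith
    obtain ⟨n, hn⟩ := pow_unbounded_of_one_lt (Metric.diam ({p, q, r} : Set E) / δ)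
      (one_lt_two : (1:ℝ) < 2)
    refine scale n p q r _ ?_ ?_ ?_ ((div_lt_iff₀ hδ).1 hn) <;> rw [Metric.diam_triple] <;> simp
  refine abs_nonpos_iff.1 (le_of_forall_pos_le_add fun η hη => ?_)
  set d := Metric.diam ({p, q, r} : Set E)
  calc |W p q r| ≤ η / (d ^ 2 + 1) * d ^ 2 := bound _ (by positivity)
    _ ≤ 0 + η := by
      rw [div_mul_eq_mul_div, div_le_iff₀ (by positivity)]
      nlinarith

/-- uniqueness of the pair `(S, V)` associated with a 2-germ `ω`. -/
theorem stmt_18 (ω : E2 → E2 → E2 → ℝ)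
    (S S' : E2 → E2 → ℝ) (V V' : E2 → E2 → E2 → ℝ)
    -- conditions (a)–(d) for (S, V)
    (ha : ∀ ε > (0:ℝ), ∃ δ > (0:ℝ), ∀ p q : E2, dist p q < δ → |S p q| ≤ ε * dist p q)
    (hb : ∀ ε > (0:ℝ), ∃ δ > (0:ℝ), ∀ p q r : E2, Metric.diam ({p, q, r} : Set E2) < δ →
      |ω p q r - V p q r + (S q r - S p r + S p q)| ≤ ε * Metric.diam ({p, q, r} : Set E2) ^ 2)
    (hc : ∀ p q : E2,
      S (midpoint ℝ p q) q - S p q + S p (midpoint ℝ p q) = ω p (midpoint ℝ p q) q)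
    (hd : ∀ p0 p1 p2 : E2,
      V p0 p1 p2 =
        V (midpoint ℝ p1 p2) (midpoint ℝ p0 p2) (midpoint ℝ p0 p1)
        + V (midpoint ℝ p0 p2) (midpoint ℝ p1 p2) p2
        + V (midpoint ℝ p0 p1) p1 (midpoint ℝ p1 p2)
        + V p0 (midpoint ℝ p0 p1) (midpoint ℝ p0 p2))
    -- conditions (a)–(d) for (S', V')
    (ha' : ∀ ε > (0:ℝ), ∃ δ > (0:ℝ), ∀ p q : E2, dist p q < δ → |S' p q| ≤ ε * dist p q)
    (hb' : ∀ ε > (0:ℝ), ∃ δ > (0:ℝ), ∀ p q r : E2, Metric.diam ({p, q, r} : Set E2) < δ →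
      |ω p q r - V' p q r + (S' q r - S' p r + S' p q)| ≤ ε * Metric.diam ({p, q, r} : Set E2) ^ 2)
    (hc' : ∀ p q : E2,
      S' (midpoint ℝ p q) q - S' p q + S' p (midpoint ℝ p q) = ω p (midpoint ℝ p q) q)
    (hd' : ∀ p0 p1 p2 : E2,
      V' p0 p1 p2 =
        V' (midpoint ℝ p1 p2) (midpoint ℝ p0 p2) (midpoint ℝ p0 p1)
        + V' (midpoint ℝ p0 p2) (midpoint ℝ p1 p2) p2
        + V' (midpoint ℝ p0 p1) p1 (midpoint ℝ p1 p2)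
        + V' p0 (midpoint ℝ p0 p1) (midpoint ℝ p0 p2)) :
    S = S' ∧ V = V' := by
  have hS : S = S' := by
    funext p q
    refine sub_eq_zero.1 (eq_zero_of_midpoint_additive (fun p q => S p q - S' p q)
      (fun ε hε => ?_) (fun p q => ?_) p q)
    · obtain ⟨δ, hδ, h⟩ := ha (ε / 2) (by positivity)
      obtain ⟨δ', hδ', h'⟩ := ha' (ε / 2) (by positivity)
      refine ⟨min δ δ', lt_min hδ hδ', fun p q hpq => ?_⟩
      have h₁ := h p q (hpq.trans_le (min_le_left _ _))
      have h₂ := h' p q (hpq.trans_le (min_le_right _ _))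
      linarith [abs_sub (S p q) (S' p q)]
    · linarith [hc p q, hc' p q]
  subst hS
  refine ⟨rfl, ?_⟩
  funext p q r
  refine sub_eq_zero.1 (eq_zero_of_dyadic_additive (fun p q r => V p q r - V' p q r)
    (fun ε hε => ?_) (fun p q r => ?_) p q r)
  · obtain ⟨δ, hδ, h⟩ := hb (ε / 2) (by positivity)
    obtain ⟨δ', hδ', h'⟩ := hb' (ε / 2) (by positivity)
    refine ⟨min δ δ', lt_min hδ hδ', fun p q r hpqr => ?_⟩
    have h₁ := h p q r (hpqr.trans_le (min_le_left _ _))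
    have h₂ := h' p q r (hpqr.trans_le (min_le_right _ _))
    rw [abs_le] at *
    constructor <;> linarith
  · linarith [hd p q r, hd' p q r]
end
end

section
/- Let γ₁ > 1, γ₂ > 2 and C₁, C₂ > 0. Let ω_k : (ℝ²)³ → ℝ (k ∈ ℕ) be continuous alternating 2-germs satisfying, uniformly in k, |(ω_k)_{pqr}| ≤ C₁·diam([pqr])^{γ₁} and |(δω_k)_{pqrs}| ≤ C₂·diam([pqrs])^{γ₂} for all p, q, r, s ∈ ℝ², and suppose ω_k → ω pointwise as k → ∞. Then, with S_k := lim_{n→∞} S_k^n, V_k := lim_{n→∞} ω_k^n, S := lim_{n→∞} S^n and V := lim_{n→∞} ω^n (all these limits exist), one has S_k → S and V_k → V pointwise as k → ∞. -/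
open Filter Metric

noncomputable section

theorem Alternating2.swap_left {ω : E2 → E2 → E2 → ℝ} (h : Alternating2 ω) (p q r : E2) :
    ω q p r = -ω p q r := by
  have := h (Equiv.swap 0 1) ![p, q, r]
  rw [Equiv.Perm.sign_swap (by decide), Equiv.swap_apply_left, Equiv.swap_apply_right,
    Equiv.swap_apply_of_ne_of_ne (by decide) (by decide)] at this
  simpa using this

theorem Alternating2.swap_right {ω : E2 → E2 → E2 → ℝ} (h : Alternating2 ω) (p q r : E2) :
    ω p r q = -ω p q r := by
  have := h (Equiv.swap 1 2) ![p, q, r]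
  rw [Equiv.Perm.sign_swap (by decide), Equiv.swap_apply_left, Equiv.swap_apply_right,
    Equiv.swap_apply_of_ne_of_ne (by decide) (by decide)] at this
  simpa using this

theorem Alternating2.reverse {ω : E2 → E2 → E2 → ℝ} (h : Alternating2 ω) (p q r : E2) :
    ω r q p = -ω p q r := by
  rw [h.swap_left, h.swap_right, h.swap_left, neg_neg]

theorem Alternating2.of_tendsto {ωk : ℕ → E2 → E2 → E2 → ℝ} {ω : E2 → E2 → E2 → ℝ}
    (halt : ∀ k, Alternating2 (ωk k))
    (hω : ∀ p q r, Tendsto (fun k => ωk k p q r) atTop (nhds (ω p q r))) :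
    Alternating2 ω := by
  intro σ p
  refine tendsto_nhds_unique (hω _ _ _) ?_
  simp only [fun k => halt k σ p]
  exact (hω _ _ _).const_mul _

theorem Alternating2.sideCorr_swap {ω : E2 → E2 → E2 → ℝ} (h : Alternating2 ω) (n : ℕ)
    (p q : E2) : sideCorr ω n q p = -sideCorr ω n p q := by
  induction n generalizing p q with
  | zero => simp [sideCorr]
  | succ n ih =>
    simp only [sideCorr]
    rw [midpoint_comm q p, h.reverse, ih (midpoint ℝ p q) q, ih p (midpoint ℝ p q)]
    ring

/-- The increments `S^{n+1} - S^n` of the side correctors. -/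
def sideIncr (ω : E2 → E2 → E2 → ℝ) (n : ℕ) (p q : E2) : ℝ :=
  sideCorr ω (n + 1) p q - sideCorr ω n p q

/-- The sum of the side correctors along the boundary of a triangle. -/
def sideSum (ω : E2 → E2 → E2 → ℝ) (n : ℕ) (p q r : E2) : ℝ :=
  sideCorr ω n p q + sideCorr ω n q r + sideCorr ω n r p

/-- The increments of the dyadic sums corrected by their boundary terms. -/
def dyaIncr (ω : E2 → E2 → E2 → ℝ) (n : ℕ) (p q r : E2) : ℝ :=
  (dyaSum ω (n + 1) p q r - sideSum ω (n + 1) p q r) - (dyaSum ω n p q r - sideSum ω n p q r)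

theorem sideCorr_eq_sum (ω : E2 → E2 → E2 → ℝ) (n : ℕ) (p q : E2) :
    sideCorr ω n p q = ∑ j ∈ Finset.range n, sideIncr ω j p q := by
  simp only [sideIncr, Finset.sum_range_sub (fun j => sideCorr ω j p q)]
  simp [sideCorr]

theorem dyaSum_eq_sum (ω : E2 → E2 → E2 → ℝ) (n : ℕ) (p q r : E2) :
    dyaSum ω n p q r =
      ω p q r + ∑ j ∈ Finset.range n, dyaIncr ω j p q r + sideSum ω n p q r := by
  simp only [dyaIncr, Finset.sum_range_sub (fun j => dyaSum ω j p q r - sideSum ω j p q r)]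
  simp [dyaSum, sideSum, sideCorr]

theorem sideIncr_succ (ω : E2 → E2 → E2 → ℝ) (n : ℕ) (p q : E2) :
    sideIncr ω (n + 1) p q =
      sideIncr ω n p (midpoint ℝ p q) + sideIncr ω n (midpoint ℝ p q) q := by
  have h (m : ℕ) : sideCorr ω (m + 1) p q = ω p (midpoint ℝ p q) q
      + sideCorr ω m p (midpoint ℝ p q) + sideCorr ω m (midpoint ℝ p q) q := rfl
  rw [sideIncr, h, h, sideIncr, sideIncr]
  ring

theorem sideSum_succ {ω : E2 → E2 → E2 → ℝ} (h : Alternating2 ω) (n : ℕ) (p q r : E2) :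
    sideSum ω (n + 1) p q r =
      ω p (midpoint ℝ p q) q + ω q (midpoint ℝ q r) r + ω r (midpoint ℝ p r) p
      + (sideSum ω n (midpoint ℝ q r) (midpoint ℝ p r) (midpoint ℝ p q)
      + sideSum ω n (midpoint ℝ p r) (midpoint ℝ q r) r
      + sideSum ω n (midpoint ℝ p q) q (midpoint ℝ q r)
      + sideSum ω n p (midpoint ℝ p q) (midpoint ℝ p r)) := by
  simp only [sideSum, sideCorr, midpoint_comm r p]
  linarith [h.sideCorr_swap n (midpoint ℝ q r) (midpoint ℝ p r),
    h.sideCorr_swap n (midpoint ℝ p r) (midpoint ℝ p q),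
    h.sideCorr_swap n (midpoint ℝ p q) (midpoint ℝ q r)]

theorem dyaIncr_succ {ω : E2 → E2 → E2 → ℝ} (h : Alternating2 ω) (n : ℕ) (p q r : E2) :
    dyaIncr ω (n + 1) p q r =
      dyaIncr ω n (midpoint ℝ q r) (midpoint ℝ p r) (midpoint ℝ p q)
      + dyaIncr ω n (midpoint ℝ p r) (midpoint ℝ q r) r
      + dyaIncr ω n (midpoint ℝ p q) q (midpoint ℝ q r)
      + dyaIncr ω n p (midpoint ℝ p q) (midpoint ℝ p r) := by
  have hdya (m : ℕ) : dyaSum ω (m + 1) p q r =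
      dyaSum ω m (midpoint ℝ q r) (midpoint ℝ p r) (midpoint ℝ p q)
      + dyaSum ω m (midpoint ℝ p r) (midpoint ℝ q r) r
      + dyaSum ω m (midpoint ℝ p q) q (midpoint ℝ q r)
      + dyaSum ω m p (midpoint ℝ p q) (midpoint ℝ p r) := rfl
  rw [dyaIncr, sideSum_succ h (n + 1) p q r, sideSum_succ h n p q r, hdya, hdya]
  simp only [dyaIncr]
  ring

theorem dyaIncr_zero {ω : E2 → E2 → E2 → ℝ} (h : Alternating2 ω) (p q r : E2) :
    dyaIncr ω 0 p q r =
      cob ω p (midpoint ℝ p q) q r - cob ω (midpoint ℝ p q) q (midpoint ℝ q r) r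
      - cob ω p (midpoint ℝ p q) (midpoint ℝ p r) r
      - cob ω (midpoint ℝ q r) (midpoint ℝ p r) (midpoint ℝ p q) r := by
  simp only [dyaIncr, sideSum, sideCorr, dyaSum, cob, midpoint_comm r p]
  linarith [h.reverse p (midpoint ℝ p r) r, h.swap_left (midpoint ℝ q r) (midpoint ℝ p q) r,
    h.swap_left (midpoint ℝ p r) (midpoint ℝ p q) r,
    h.swap_left (midpoint ℝ q r) (midpoint ℝ p r) r]

/-- The diameter of a subset of a triangle is at most any bound on its side lengths. -/
theorem diam_le_of_subset_convexHull {p q r : E2} {d : ℝ} (hpq : dist p q ≤ d)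
    (hpr : dist p r ≤ d) (hqr : dist q r ≤ d) {s : Set E2}
    (hs : s ⊆ convexHull ℝ {p, q, r}) : diam s ≤ d := by
  have hb : Bornology.IsBounded (convexHull ℝ {p, q, r}) :=
    isBounded_convexHull.2 (Set.toFinite _).isBounded
  refine (diam_mono hs hb).trans ?_
  rw [convexHull_diam, diam_triple]
  exact max_le (max_le hpq hpr) hqr

theorem two_mul_half_rpow_lt_one {γ : ℝ} (hγ : 1 < γ) : 2 * (1 / 2 : ℝ) ^ γ < 1 := by
  have := Real.rpow_lt_rpow_of_exponent_gt (x := 1 / 2) (by norm_num) (by norm_num) hγ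
  rw [Real.rpow_one] at this
  linarith

theorem four_mul_half_rpow_lt_one {γ : ℝ} (hγ : 2 < γ) : 4 * (1 / 2 : ℝ) ^ γ < 1 := by
  have := Real.rpow_lt_rpow_of_exponent_gt (x := 1 / 2) (by norm_num) (by norm_num) hγ
  rw [Real.rpow_two] at this
  linarith

theorem half_mul_rpow {d : ℝ} (hd : 0 ≤ d) (γ : ℝ) : (d / 2) ^ γ = (1 / 2 : ℝ) ^ γ * d ^ γ := by
  rw [← Real.mul_rpow (by norm_num) hd]
  ring_nf

theorem abs_sideIncr_le {γ C : ℝ} (hγ : 0 ≤ γ) (hC : 0 ≤ C) {ω : E2 → E2 → E2 → ℝ}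
    (hω : ∀ p q r, |ω p q r| ≤ C * diam ({p, q, r} : Set E2) ^ γ) (n : ℕ) (p q : E2) {d : ℝ}
    (hpq : dist p q ≤ d) :
    |sideIncr ω n p q| ≤ (2 * (1 / 2 : ℝ) ^ γ) ^ n * (C * d ^ γ) := by
  have hd : 0 ≤ d := dist_nonneg.trans hpq
  induction n generalizing p q d with
  | zero =>
    have hdiam : diam ({p, midpoint ℝ p q, q} : Set E2) ≤ d := by
      refine diam_le_of_subset_convexHull (r := q) hpq hpq (by simpa using hd) ?_
      have hsub := subset_convexHull ℝ ({p, q, q} : Set E2)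
      have hp := hsub (show p ∈ ({p, q, q} : Set E2) by simp)
      have hq := hsub (show q ∈ ({p, q, q} : Set E2) by simp)
      simp only [Set.insert_subset_iff, Set.singleton_subset_iff]
      exact ⟨hp, (convex_convexHull ℝ _).midpoint_mem hp hq, hq⟩
    simp only [sideIncr, sideCorr, add_zero, sub_zero, pow_zero, one_mul]
    refine (hω _ _ _).trans ?_
    gcongr
  | succ n ih =>
    rw [sideIncr_succ]
    have h₁ := ih p (midpoint ℝ p q) (d := d / 2)
      (by rw [dist_left_midpoint]; norm_num; linarith) (by positivity)
    have h₂ := ih (midpoint ℝ p q) q (d := d / 2)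
      (by rw [dist_midpoint_right]; norm_num; linarith) (by positivity)
    rw [half_mul_rpow hd] at h₁ h₂
    refine (abs_add_le _ _).trans ((add_le_add h₁ h₂).trans (le_of_eq ?_))
    ring

theorem abs_dyaIncr_le {γ C : ℝ} (hγ : 0 ≤ γ) (hC : 0 ≤ C) {ω : E2 → E2 → E2 → ℝ}
    (halt : Alternating2 ω)
    (hω : ∀ p q r s, |cob ω p q r s| ≤ C * diam ({p, q, r, s} : Set E2) ^ γ) (n : ℕ)
    (p q r : E2) {d : ℝ} (hpq : dist p q ≤ d) (hpr : dist p r ≤ d) (hqr : dist q r ≤ d) :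
    |dyaIncr ω n p q r| ≤ (4 * (1 / 2 : ℝ) ^ γ) ^ n * (4 * C * d ^ γ) := by
  have hd : 0 ≤ d := dist_nonneg.trans hpq
  induction n generalizing p q r d with
  | zero =>
    have hsub := subset_convexHull ℝ ({p, q, r} : Set E2)
    have hp := hsub (show p ∈ ({p, q, r} : Set E2) by simp)
    have hq := hsub (show q ∈ ({p, q, r} : Set E2) by simp)
    have hr := hsub (show r ∈ ({p, q, r} : Set E2) by simp)
    have hmid {x y : E2} :=
      (convex_convexHull ℝ ({p, q, r} : Set E2)).midpoint_mem (x := x) (y := y)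
    have hcob {a b c e : E2} (ha : a ∈ convexHull ℝ ({p, q, r} : Set E2))
        (hb : b ∈ convexHull ℝ ({p, q, r} : Set E2)) (hc : c ∈ convexHull ℝ ({p, q, r} : Set E2))
        (he : e ∈ convexHull ℝ ({p, q, r} : Set E2)) : |cob ω a b c e| ≤ C * d ^ γ := by
      have hdiam : diam ({a, b, c, e} : Set E2) ≤ d := by
        refine diam_le_of_subset_convexHull hpq hpr hqr ?_
        simp only [Set.insert_subset_iff, Set.singleton_subset_iff]
        exact ⟨ha, hb, hc, he⟩
      refine (hω _ _ _ _).trans ?_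
      gcongr
    rw [dyaIncr_zero halt, pow_zero, one_mul]
    have h₁ := abs_le.1 (hcob hp (hmid hp hq) hq hr)
    have h₂ := abs_le.1 (hcob (hmid hp hq) hq (hmid hq hr) hr)
    have h₃ := abs_le.1 (hcob hp (hmid hp hq) (hmid hp hr) hr)
    have h₄ := abs_le.1 (hcob (hmid hq hr) (hmid hp hr) (hmid hp hq) hr)
    rw [abs_le]
    constructor <;> linarith
  | succ n ih =>
    have hleft (a b : E2) : dist a (midpoint ℝ a b) = dist a b / 2 := by
      rw [dist_left_midpoint]; norm_num; ring
    have hright (a b : E2) : dist (midpoint ℝ a b) b = dist a b / 2 := by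
      rw [dist_midpoint_right]; norm_num; ring
    have hmid (a b c : E2) : dist (midpoint ℝ a b) (midpoint ℝ a c) = dist b c / 2 := by
      simp [dist_eq_norm, midpoint_eq_smul_add, ← smul_sub, norm_smul]; ring
    have h₁ : dist (midpoint ℝ q r) (midpoint ℝ p r) ≤ d / 2 := by
      rw [midpoint_comm q r, midpoint_comm p r, hmid, dist_comm]; linarith
    have h₂ : dist (midpoint ℝ q r) (midpoint ℝ p q) ≤ d / 2 := by
      rw [midpoint_comm p q, hmid, dist_comm]; linarith
    have h₃ : dist (midpoint ℝ p r) (midpoint ℝ p q) ≤ d / 2 := by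
      rw [hmid, dist_comm]; linarith
    have hp₁ : dist p (midpoint ℝ p q) ≤ d / 2 := by rw [hleft]; linarith
    have hp₂ : dist p (midpoint ℝ p r) ≤ d / 2 := by rw [hleft]; linarith
    have hq₁ : dist (midpoint ℝ p q) q ≤ d / 2 := by rw [hright]; linarith
    have hq₂ : dist q (midpoint ℝ q r) ≤ d / 2 := by rw [hleft]; linarith
    have hr₁ : dist (midpoint ℝ p r) r ≤ d / 2 := by rw [hright]; linarith
    have hr₂ : dist (midpoint ℝ q r) r ≤ d / 2 := by rw [hright]; linarith
    have hd₂ : 0 ≤ d / 2 := by positivity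
    have b₁ := abs_le.1 (ih _ _ _ h₁ h₂ h₃ hd₂)
    have b₂ := abs_le.1 (ih _ _ _ (dist_comm (midpoint ℝ q r) _ ▸ h₁) hr₁ hr₂ hd₂)
    have b₃ := abs_le.1 (ih _ _ _ hq₁ (dist_comm (midpoint ℝ q r) _ ▸ h₂) hq₂ hd₂)
    have b₄ := abs_le.1 (ih _ _ _ hp₁ hp₂ (dist_comm (midpoint ℝ p r) _ ▸ h₃) hd₂)
    rw [half_mul_rpow hd] at b₁ b₂ b₃ b₄
    have e : (4 * (1 / 2 : ℝ) ^ γ) ^ (n + 1) * (4 * C * d ^ γ) =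
        4 * ((4 * (1 / 2 : ℝ) ^ γ) ^ n * (4 * C * ((1 / 2 : ℝ) ^ γ * d ^ γ))) := by ring
    rw [dyaIncr_succ halt, e, abs_le]
    constructor <;> linarith

theorem tendsto_sideCorr {ωk : ℕ → E2 → E2 → E2 → ℝ} {ω : E2 → E2 → E2 → ℝ}
    (hω : ∀ p q r, Tendsto (fun k => ωk k p q r) atTop (nhds (ω p q r))) (n : ℕ) (p q : E2) :
    Tendsto (fun k => sideCorr (ωk k) n p q) atTop (nhds (sideCorr ω n p q)) := by
  induction n generalizing p q with
  | zero => exact tendsto_const_nhds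
  | succ n ih => exact ((hω _ _ _).add (ih _ _)).add (ih _ _)

theorem tendsto_dyaSum {ωk : ℕ → E2 → E2 → E2 → ℝ} {ω : E2 → E2 → E2 → ℝ}
    (hω : ∀ p q r, Tendsto (fun k => ωk k p q r) atTop (nhds (ω p q r))) (n : ℕ) (p q r : E2) :
    Tendsto (fun k => dyaSum (ωk k) n p q r) atTop (nhds (dyaSum ω n p q r)) := by
  induction n generalizing p q r with
  | zero => exact hω _ _ _
  | succ n ih => exact (((ih _ _ _).add (ih _ _ _)).add (ih _ _ _)).add (ih _ _ _)

theorem tendsto_sideSum {ωk : ℕ → E2 → E2 → E2 → ℝ} {ω : E2 → E2 → E2 → ℝ}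
    (hω : ∀ p q r, Tendsto (fun k => ωk k p q r) atTop (nhds (ω p q r))) (n : ℕ) (p q r : E2) :
    Tendsto (fun k => sideSum (ωk k) n p q r) atTop (nhds (sideSum ω n p q r)) :=
  ((tendsto_sideCorr hω n _ _).add (tendsto_sideCorr hω n _ _)).add (tendsto_sideCorr hω n _ _)

/-- The limit of the side correctors. -/
def sideLim (ω : E2 → E2 → E2 → ℝ) (p q : E2) : ℝ := ∑' n, sideIncr ω n p q

/-- The limit of the dyadic sums. -/
def dyaLim (ω : E2 → E2 → E2 → ℝ) (p q r : E2) : ℝ :=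
  ω p q r + ∑' n, dyaIncr ω n p q r + (sideLim ω p q + sideLim ω q r + sideLim ω r p)

theorem tendsto_sideCorr_sideLim {ω : E2 → E2 → E2 → ℝ} {p q : E2}
    (h : Summable fun n => sideIncr ω n p q) :
    Tendsto (fun n => sideCorr ω n p q) atTop (nhds (sideLim ω p q)) := by
  simp only [sideCorr_eq_sum]
  exact h.hasSum.tendsto_sum_nat

theorem tendsto_dyaSum_dyaLim {ω : E2 → E2 → E2 → ℝ} {p q r : E2}
    (hs : ∀ p q, Summable fun n => sideIncr ω n p q) (hd : Summable fun n => dyaIncr ω n p q r) :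
    Tendsto (fun n => dyaSum ω n p q r) atTop (nhds (dyaLim ω p q r)) := by
  simp only [dyaSum_eq_sum]
  exact (hd.hasSum.tendsto_sum_nat.const_add _).add
    (((tendsto_sideCorr_sideLim (hs _ _)).add (tendsto_sideCorr_sideLim (hs _ _))).add
      (tendsto_sideCorr_sideLim (hs _ _)))

/-- stability of the limits `S` and `V` under pointwise convergence of germs
with uniform bounds. -/
theorem stmt_19 (γ₁ γ₂ C₁ C₂ : ℝ) (hγ₁ : 1 < γ₁) (hγ₂ : 2 < γ₂) (hC₁ : 0 < C₁) (hC₂ : 0 < C₂)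
    (ωk : ℕ → E2 → E2 → E2 → ℝ) (ω : E2 → E2 → E2 → ℝ)
    (hcont : ∀ k, Continuous (fun x : E2 × E2 × E2 => ωk k x.1 x.2.1 x.2.2))
    (halt : ∀ k, Alternating2 (ωk k))
    (hbd1 : ∀ k p q r, |ωk k p q r| ≤ C₁ * Metric.diam ({p, q, r} : Set E2) ^ γ₁)
    (hbd2 : ∀ k p q r s, |cob (ωk k) p q r s| ≤ C₂ * Metric.diam ({p, q, r, s} : Set E2) ^ γ₂)
    (hptw : ∀ p q r, Tendsto (fun k => ωk k p q r) atTop (nhds (ω p q r))) :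
    ∃ (Sk : ℕ → E2 → E2 → ℝ) (Vk : ℕ → E2 → E2 → E2 → ℝ)
      (S : E2 → E2 → ℝ) (V : E2 → E2 → E2 → ℝ),
      (∀ k p q, Tendsto (fun n => sideCorr (ωk k) n p q) atTop (nhds (Sk k p q))) ∧
      (∀ k p q r, Tendsto (fun n => dyaSum (ωk k) n p q r) atTop (nhds (Vk k p q r))) ∧
      (∀ p q, Tendsto (fun n => sideCorr ω n p q) atTop (nhds (S p q))) ∧
      (∀ p q r, Tendsto (fun n => dyaSum ω n p q r) atTop (nhds (V p q r))) ∧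
      (∀ p q, Tendsto (fun k => Sk k p q) atTop (nhds (S p q))) ∧
      (∀ p q r, Tendsto (fun k => Vk k p q r) atTop (nhds (V p q r))) := by
  have halt' : Alternating2 ω := .of_tendsto halt hptw
  have hbd1' : ∀ p q r, |ω p q r| ≤ C₁ * Metric.diam ({p, q, r} : Set E2) ^ γ₁ := fun p q r =>
    le_of_tendsto (hptw p q r).abs (Eventually.of_forall fun k => hbd1 k p q r)
  have hbd2' : ∀ p q r s, |cob ω p q r s| ≤ C₂ * Metric.diam ({p, q, r, s} : Set E2) ^ γ₂ :=
    fun p q r s => le_of_tendsto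
      ((((hptw q r s).sub (hptw p r s)).add (hptw p q s)).sub (hptw p q r)).abs
      (Eventually.of_forall fun k => hbd2 k p q r s)
  have hsum1 : ∀ c, Summable fun n : ℕ => (2 * (1 / 2 : ℝ) ^ γ₁) ^ n * c := fun c =>
    (summable_geometric_of_lt_one (by positivity) (two_mul_half_rpow_lt_one hγ₁)).mul_right c
  have hsum2 : ∀ c, Summable fun n : ℕ => (4 * (1 / 2 : ℝ) ^ γ₂) ^ n * c := fun c =>
    (summable_geometric_of_lt_one (by positivity) (four_mul_half_rpow_lt_one hγ₂)).mul_right c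
  have hγ₁0 : 0 ≤ γ₁ := by linarith
  have hγ₂0 : 0 ≤ γ₂ := by linarith
  have hS {η : E2 → E2 → E2 → ℝ}
      (h : ∀ p q r, |η p q r| ≤ C₁ * Metric.diam ({p, q, r} : Set E2) ^ γ₁) (p q : E2) :
      Summable fun n => sideIncr η n p q :=
    .of_norm_bounded (hsum1 _) fun n => abs_sideIncr_le hγ₁0 hC₁.le h n p q le_rfl
  have hside {a b c : E2} : dist a b ≤ dist a b + dist a c + dist b c ∧
      dist a c ≤ dist a b + dist a c + dist b c ∧ dist b c ≤ dist a b + dist a c + dist b c := by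
    refine ⟨?_, ?_, ?_⟩ <;> linarith [dist_nonneg (x := a) (y := b), dist_nonneg (x := a) (y := c),
      dist_nonneg (x := b) (y := c)]
  have hV {η : E2 → E2 → E2 → ℝ} (ha : Alternating2 η)
      (h : ∀ p q r s, |cob η p q r s| ≤ C₂ * Metric.diam ({p, q, r, s} : Set E2) ^ γ₂)
      (p q r : E2) : Summable fun n => dyaIncr η n p q r :=
    .of_norm_bounded (hsum2 _) fun n =>
      abs_dyaIncr_le hγ₂0 hC₂.le ha h n p q r hside.1 hside.2.1 hside.2.2
  have hSlim (p q : E2) : Tendsto (fun k => sideLim (ωk k) p q) atTop (nhds (sideLim ω p q)) :=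
    tendsto_tsum_of_dominated_convergence (hsum1 _)
      (fun n => (tendsto_sideCorr hptw (n + 1) p q).sub (tendsto_sideCorr hptw n p q))
      (Eventually.of_forall fun k n => abs_sideIncr_le hγ₁0 hC₁.le (hbd1 k) n p q le_rfl)
  have hDlim (p q r : E2) : Tendsto (fun k => ∑' n, dyaIncr (ωk k) n p q r) atTop
      (nhds (∑' n, dyaIncr ω n p q r)) :=
    tendsto_tsum_of_dominated_convergence (hsum2 _)
      (fun n => ((tendsto_dyaSum hptw (n + 1) p q r).sub (tendsto_sideSum hptw (n + 1) p q r)).sub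
        ((tendsto_dyaSum hptw n p q r).sub (tendsto_sideSum hptw n p q r)))
      (Eventually.of_forall fun k n => abs_dyaIncr_le hγ₂0 hC₂.le (halt k) (hbd2 k) n p q r
        hside.1 hside.2.1 hside.2.2)
  exact ⟨fun k => sideLim (ωk k), fun k => dyaLim (ωk k), sideLim ω, dyaLim ω,
    fun k p q => tendsto_sideCorr_sideLim (hS (hbd1 k) p q),
    fun k p q r => tendsto_dyaSum_dyaLim (hS (hbd1 k)) (hV (halt k) (hbd2 k) p q r),
    fun p q => tendsto_sideCorr_sideLim (hS hbd1' p q),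
    fun p q r => tendsto_dyaSum_dyaLim (hS hbd1') (hV halt' hbd2' p q r),
    hSlim,
    fun p q r => ((hptw p q r).add (hDlim p q r)).add
      (((hSlim p q).add (hSlim q r)).add (hSlim r p))⟩
end
end
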